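/- The kernel of the linear map A ↦ A⋄Φ₀, from the (64-dimensional) space of linear endomorphisms of ℝ⁸ to the space of alternating 4-forms on ℝ⁸, is exactly the set of skew-adjoint endomorphisms A (i.e. ⟨Ax,y⟩ = −⟨x,Ay⟩) whose associated 2-form α_A(x,y) := ⟨Ax,y⟩ lies in Λ²₂₁ = ker(M + id); in particular this kernel has dimension 21. -/

import Mathlib

open scoped TensorProduct
open Matrix

noncomputable section

/-- `ℝ⁸` with its standard basis. -/
abbrev V : Type := Fin 8 → ℝ

/-- Alternating `k`-forms on `ℝ⁸`. -/
abbrev Form (k : ℕ) : Type := V [⋀^Fin k]→ₗ[ℝ] ℝ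

/-- Standard basis vector `eᵢ` of `ℝ⁸`. -/
def e (i : Fin 8) : V := Pi.single i 1

/-- The elementary 4-form `eⁱ∧eʲ∧eᵏ∧eˡ` (determinant convention). -/
def E4 (i j k l : Fin 8) : Form 4 :=
  (Matrix.detRowAlternating : (Fin 4 → ℝ) [⋀^Fin 4]→ₗ[ℝ] ℝ).compLinearMap
    (LinearMap.funLeft ℝ ℝ ![i, j, k, l])

/-- The Cayley 4-form `Φ₀` on `ℝ⁸` (indices shifted from `1,…,8` to `0,…,7`):
`Φ₀ = e^{1234}+e^{1256}+e^{1278}+e^{1357}−e^{1368}−e^{1458}−e^{1467}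
      +e^{5678}+e^{3478}+e^{3456}+e^{2468}−e^{2457}−e^{2367}−e^{2358}`. -/
def Φ₀ : Form 4 :=
  E4 0 1 2 3 + E4 0 1 4 5 + E4 0 1 6 7 + E4 0 2 4 6 - E4 0 2 5 7 - E4 0 3 4 7 - E4 0 3 5 6
    + E4 4 5 6 7 + E4 2 3 6 7 + E4 2 3 4 5 + E4 1 3 5 7 - E4 1 3 4 6 - E4 1 2 5 6 - E4 1 2 4 7

/-- The standard volume form `e¹∧e²∧⋯∧e⁸` of `ℝ⁸`. -/
def vol₀ : Form 8 := Matrix.detRowAlternating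

/-- The wedge product of alternating forms (shuffle convention, so that
`(e¹∧e²)(e₁,e₂) = 1`). -/
def wedge {k l : ℕ} (α : Form k) (β : Form l) : Form (k + l) :=
  AlternatingMap.domDomCongr finSumFinEquiv
    ((LinearMap.mul' ℝ ℝ).compAlternatingMap (AlternatingMap.domCoprod α β))

/-- The double contraction `v ⌟ w ⌟ Φ`, i.e. the alternating 2-form
`(x, y) ↦ Φ (w, v, x, y)`. -/
def contr (v w : V) (Φ : Form 4) : Form 2 :=
  AlternatingMap.curryLeft (AlternatingMap.curryLeft Φ w) v

/-- The inner product on alternating `k`-forms on `ℝ⁸` making the forms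
`e^{i₁}∧⋯∧e^{i_k}` with `i₁<⋯<i_k` an orthonormal basis. -/
def formInner {k : ℕ} (α β : Form k) : ℝ :=
  ∑ s : Finset (Fin 8),
    if h : s.card = k then
      α (fun a => e ((s.orderIsoOfFin h a : Fin 8))) *
        β (fun a => e ((s.orderIsoOfFin h a : Fin 8)))
    else 0

/-- A 4-form `Ψ` on `ℝ⁸` is admissible (a `Spin(7)`-form) if `Ψ = g*Φ₀` for some
`g ∈ GL(8,ℝ)`, where `(g*Φ₀)(x,y,z,w) = Φ₀(gx,gy,gz,gw)`. -/
def Admissible (Ψ : Form 4) : Prop :=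
  ∃ g : V →ₗ[ℝ] V, Function.Bijective g ∧ Ψ = Φ₀.compLinearMap g

/-- The elementary `k`-form `e^{f 0} ∧ ⋯ ∧ e^{f (k-1)}`. -/
def elemForm {k : ℕ} (f : Fin k → Fin 8) : Form k :=
  (Matrix.detRowAlternating : (Fin k → ℝ) [⋀^Fin k]→ₗ[ℝ] ℝ).compLinearMap
    (LinearMap.funLeft ℝ ℝ f)

theorem elemForm_apply {k : ℕ} (f : Fin k → Fin 8) (v : Fin k → V) :
    elemForm f v = Matrix.det (Matrix.of fun a b => v a (f b)) := rfl

theorem elemForm_eq_alternatization {k : ℕ} (f : Fin k → Fin 8) :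
    elemForm f = MultilinearMap.alternatization
      ((MultilinearMap.mkPiAlgebra ℝ (Fin k) ℝ).compLinearMap fun i => LinearMap.proj (f i)) := by
  ext v
  simp [elemForm, Matrix.detRowAlternating, MultilinearMap.alternatization_apply]

theorem wedge_elemForm {k l : ℕ} (f : Fin k → Fin 8) (g : Fin l → Fin 8) :
    wedge (elemForm f) (elemForm g) = elemForm (Fin.append f g) := by
  ext v
  simp only [wedge, elemForm_eq_alternatization, ← MultilinearMap.domCoprod_alternization]
  simp only [AlternatingMap.domDomCongr_apply, LinearMap.compAlternatingMap_apply,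
    MultilinearMap.alternatization_apply, map_sum]
  refine Fintype.sum_equiv finSumFinEquiv.permCongr _ _ fun σ => ?_
  rcases Int.units_eq_one_or (Equiv.Perm.sign σ) with h | h <;>
    simp [h, Fin.prod_univ_add, Equiv.permCongr_apply]

theorem Form.sum_apply {ι : Type*} {k : ℕ} (s : Finset ι) (f : ι → Form k) (v : Fin k → V) :
    (∑ i ∈ s, f i) v = ∑ i ∈ s, f i v :=
  map_sum (⟨⟨fun g => g v, rfl⟩, fun _ _ => rfl⟩ : Form k →+ ℝ) f s

/-- The wedge product as a bilinear map. -/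
def wedgeBilin (k l : ℕ) : Form k →ₗ[ℝ] Form l →ₗ[ℝ] Form (k + l) :=
  LinearMap.mk₂ ℝ wedge
    (fun α β γ => by
      ext v; simp [wedge, ← AlternatingMap.domCoprod'_apply, TensorProduct.add_tmul])
    (fun c α β => by
      ext v; simp [wedge, ← AlternatingMap.domCoprod'_apply, ← TensorProduct.smul_tmul'])
    (fun α β γ => by
      ext v; simp [wedge, ← AlternatingMap.domCoprod'_apply, TensorProduct.tmul_add])
    (fun c α β => by
      ext v; simp [wedge, ← AlternatingMap.domCoprod'_apply])

theorem wedgeBilin_apply {k l : ℕ} (α : Form k) (β : Form l) :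
    wedgeBilin k l α β = wedge α β := rfl

/-- Forms agreeing on increasing tuples of basis vectors are equal. -/
theorem form_ext_strictMono {k : ℕ} {f g : Form k}
    (h : ∀ v : Fin k → Fin 8, StrictMono v → f (fun a => e (v a)) = g fun a => e (v a)) :
    f = g := by
  refine (Pi.basisFun ℝ (Fin 8)).ext_alternating fun v hv => ?_
  have hmono : StrictMono (v ∘ Tuple.sort v) :=
    (Tuple.monotone_sort v).strictMono_of_injective (hv.comp (Tuple.sort v).injective)
  have key := h _ hmono
  have hf (f : Form k) : f (fun a => e ((v ∘ Tuple.sort v) a)) =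
      Equiv.Perm.sign (Tuple.sort v) • f fun a => e (v a) :=
    f.map_perm (fun a => e (v a)) (Tuple.sort v)
  rw [hf, hf] at key
  have key := smul_left_cancel _ key
  simpa [e] using key

theorem e_apply (i j : Fin 8) : e i j = if i = j then 1 else 0 := by
  simp [e, Pi.single_apply, eq_comm]

theorem elemForm_pair_apply_e (i j k l : Fin 8) :
    elemForm ![i, j] ![e k, e l] =
      (if k = i then 1 else 0) * (if l = j then 1 else 0) -
        (if k = j then 1 else 0) * (if l = i then 1 else 0) := by
  rw [elemForm_apply, Matrix.det_fin_two]
  simp [e_apply]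
  congr 1
  split_ifs <;> simp_all

/-- Expansion of a 2-form in elementary 2-forms. -/
theorem form_two_eq_sum (α : Form 2) :
    α = ∑ i, ∑ j, (α ![e i, e j] / 2) • elemForm ![i, j] := by
  refine form_ext_strictMono fun v _ => ?_
  have hv : (fun a => e (v a)) = ![e (v 0), e (v 1)] := by
    ext a : 1; fin_cases a <;> rfl
  have hswap : α ![e (v 1), e (v 0)] = -α ![e (v 0), e (v 1)] := by
    rw [← α.map_swap _ (show (0 : Fin 2) ≠ 1 by decide)]
    congr 1; ext a : 1; fin_cases a <;> rfl
  rw [hv]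
  simp only [Form.sum_apply, AlternatingMap.smul_apply, elemForm_pair_apply_e]
  simp [mul_sub, Finset.sum_sub_distrib, hswap]
  ring

theorem formInner_elemForm_pair (α : Form 2) {k l : Fin 8} (hkl : k < l) :
    formInner α (elemForm ![k, l]) = α ![e k, e l] := by
  have hcard : ({k, l} : Finset (Fin 8)).card = 2 := Finset.card_pair hkl.ne
  have hpair (f : Fin 2 → Fin 8) : (fun a => e (f a)) = ![e (f 0), e (f 1)] := by
    ext a : 1; fin_cases a <;> rfl
  rw [formInner, Finset.sum_eq_single {k, l}]
  · have hval : ![k, l] = ({k, l} : Finset (Fin 8)).orderEmbOfFin hcard := by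
      refine Finset.orderEmbOfFin_unique hcard (fun a => ?_) ?_
      · fin_cases a <;> simp
      · intro a b hab
        fin_cases a <;> fin_cases b <;> simp_all
    rw [dif_pos hcard]
    simp only [Finset.coe_orderIsoOfFin_apply, ← hval, hpair, elemForm_pair_apply_e]
    simp [hkl.ne]
  · intro s _ hs
    split_ifs with h
    · have h01 : (s.orderIsoOfFin h 0 : Fin 8) < s.orderIsoOfFin h 1 :=
        (s.orderIsoOfFin h).strictMono (by decide : (0 : Fin 2) < 1)
      rw [hpair fun a => (s.orderIsoOfFin h a : Fin 8), elemForm_pair_apply_e]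
      have hne : ¬((s.orderIsoOfFin h 0 : Fin 8) = k ∧ (s.orderIsoOfFin h 1 : Fin 8) = l) := by
        rintro ⟨h0, h1⟩
        refine hs (Finset.eq_of_subset_of_card_le ?_ (h.trans hcard.symm).le).symm
        intro x hx
        simp only [Finset.mem_insert, Finset.mem_singleton] at hx
        rcases hx with rfl | rfl
        · exact h0 ▸ (s.orderIsoOfFin h 0).2
        · exact h1 ▸ (s.orderIsoOfFin h 1).2
      have hne' : ¬((s.orderIsoOfFin h 0 : Fin 8) = l ∧ (s.orderIsoOfFin h 1 : Fin 8) = k) := by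
        rintro ⟨h0, h1⟩
        rw [h0, h1] at h01
        exact lt_asymm hkl h01
      simp only [← ite_and, ite_mul, one_mul, zero_mul, if_neg hne, if_neg hne']
      simp
    · rfl
  · simp

/-- `acc`, increased by `r` if `x = y`; written so that the kernel evaluates it quickly. -/
def addIf (x y : ℕ) (r acc : ℤ) : ℤ := bif x.beq y then r + acc else acc

/-- The value of `eᵃ ∧ eᵇ` on `(eᵢ, eⱼ)`. -/
def delta₂ (a b i j : ℕ) : ℤ :=
  addIf i a (addIf j b 1 0) <| addIf i b (-addIf j a 1 0) 0

/-- The value of `eᵃ ∧ eᵇ ∧ eᶜ` on `(eᵢ, eⱼ, eₖ)`. -/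
def delta₃ (a b c i j k : ℕ) : ℤ :=
  addIf i a (delta₂ b c j k) <| addIf i b (-delta₂ a c j k) <| addIf i c (delta₂ a b j k) 0

/-- `acc` plus `s` times the value of `eᵃ ∧ eᵇ ∧ eᶜ ∧ eᵈ` on `(eᵢ, eⱼ, eₖ, eₗ)`. -/
def delta₄ (i j k l : ℕ) (s : ℤ) (a b c d : ℕ) (acc : ℤ) : ℤ :=
  addIf i a (s * delta₃ b c d j k l) <| addIf i b (-s * delta₃ a c d j k l) <|
    addIf i c (s * delta₃ a b d j k l) <| addIf i d (-s * delta₃ a b c j k l) acc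

/-- Accumulates `F s a b c d` over the terms `s • eᵃ ∧ eᵇ ∧ eᶜ ∧ eᵈ` of the Cayley form. -/
def cayleySum (F : ℤ → ℕ → ℕ → ℕ → ℕ → ℤ → ℤ) : ℤ :=
  F 1 0 1 2 3 <| F 1 0 1 4 5 <| F 1 0 1 6 7 <| F 1 0 2 4 6 <| F (-1) 0 2 5 7 <|
    F (-1) 0 3 4 7 <| F (-1) 0 3 5 6 <| F 1 4 5 6 7 <| F 1 2 3 6 7 <| F 1 2 3 4 5 <|
    F 1 1 3 5 7 <| F (-1) 1 3 4 6 <| F (-1) 1 2 5 6 <| F (-1) 1 2 4 7 0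

/-- `r` times the sign of the number of entries smaller than `x`, or `0` if `x` is an entry. -/
def inversionSign (x : ℕ) (r : ℤ) : List ℕ → ℤ
  | [] => r
  | y :: ys => bif x.beq y then 0 else bif x.ble y then inversionSign x r ys
      else -inversionSign x r ys

/-- The sign of the permutation sorting a list, or `0` if the list has a repeated entry. -/
def listSign : List ℕ → ℤ
  | [] => 1
  | x :: xs => inversionSign x (listSign xs) xs

/-- The value of the Cayley form on `(eᵢ, eⱼ, eₖ, eₗ)`. It vanishes unless the bitwise sum of the
indices is `0`, and the negative terms of the form are then those with `60 ≤ i² + j² + k² + l² ≤ 80`. -/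
def cayleyCoeff (i j k l : ℕ) : ℤ :=
  addIf ((i.xor j).xor (k.xor l)) 0
    (bif Nat.ble 60 (i * i + j * j + k * k + l * l) &&
        Nat.ble (i * i + j * j + k * k + l * l) 80 then
      -listSign [i, j, k, l] else listSign [i, j, k, l]) 0

/-- The value of `A ⋄ Φ₀` on `(eᵢ, eⱼ, eₖ, eₗ)`, where `A` is the matrix unit in position `(m, n)`. -/
def diamondCoeff (i j k l m n : ℕ) : ℤ :=
  addIf n i (cayleyCoeff m j k l) <| addIf n j (cayleyCoeff i m k l) <|
    addIf n k (cayleyCoeff i j m l) <| addIf n l (cayleyCoeff i j k m) 0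

/-- `acc` plus `s` times the term of `eᵃ ∧ eᵇ ∧ eᶜ ∧ eᵈ` in the contraction of the diamond of the
matrix unit at `(m, n)`, a 4-form with first index `i`, with the Cayley form with first index `p`. -/
def contractAdd (p i m n : ℕ) (s : ℤ) (a b c d : ℕ) (acc : ℤ) : ℤ :=
  addIf p a (s * diamondCoeff i b c d m n) <| addIf p b (-s * diamondCoeff i a c d m n) <|
    addIf p c (s * diamondCoeff i a b d m n) <| addIf p d (-s * diamondCoeff i a b c m n) acc

/-- Whether `p` holds for all natural numbers below `8`. -/
def all8 (p : ℕ → Bool) : Bool :=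
  p 0 && p 1 && p 2 && p 3 && p 4 && p 5 && p 6 && p 7

/-- `acc` plus the part of `projSum` coming from the index `x`. -/
def projAdd (i j k l m n x : ℕ) (acc : ℤ) : ℤ :=
  addIf ((m.xor n).xor (x.xor i)) 0 (cayleyCoeff m n x i * cayleyCoeff x j k l) <|
    addIf ((m.xor n).xor (x.xor j)) 0 (cayleyCoeff m n x j * cayleyCoeff i x k l) <|
      addIf ((m.xor n).xor (x.xor k)) 0 (cayleyCoeff m n x k * cayleyCoeff i j x l) <|
        addIf ((m.xor n).xor (x.xor l)) 0 (cayleyCoeff m n x l * cayleyCoeff i j k x) acc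

/-- The value on `(eᵢ, eⱼ, eₖ, eₗ)` of the diamond of the matrix `cayleyCoeff m n`. -/
def projSum (i j k l m n : ℕ) : ℤ :=
  projAdd i j k l m n 0 <| projAdd i j k l m n 1 <| projAdd i j k l m n 2 <|
    projAdd i j k l m n 3 <| projAdd i j k l m n 4 <| projAdd i j k l m n 5 <|
      projAdd i j k l m n 6 <| projAdd i j k l m n 7 0

theorem addIf_eq (x y : ℕ) (r acc : ℤ) : addIf x y r acc = (if x = y then r else 0) + acc := by
  by_cases h : x = y
  · simp [addIf, h]
  · have : x.beq y = false := Bool.eq_false_iff.2 fun h' => h (Nat.eq_of_beq_eq_true h')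
    simp [addIf, h, this]

theorem all8_iff (p : ℕ → Bool) : all8 p = true ↔ ∀ i : Fin 8, p i = true := by
  simp [all8, Fin.forall_fin_succ, and_assoc]

theorem inversionSign_eq (x : ℕ) (r : ℤ) (l : List ℕ) :
    inversionSign x r l = (l.map fun y : ℕ => ((y : ℤ) - x).sign).prod * r := by
  induction l with
  | nil => simp [inversionSign]
  | cons y ys ih =>
    rcases lt_trichotomy x y with h | rfl | h
    · have : ((y : ℤ) - x).sign = 1 := Int.sign_eq_one_of_pos (by omega)
      have hb : x.beq y = false := Bool.eq_false_iff.2 fun h' => h.ne (Nat.eq_of_beq_eq_true h')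
      simp [inversionSign, hb, Nat.ble_eq_true_of_le h.le, this, ih]
    · simp [inversionSign]
    · have : ((y : ℤ) - x).sign = -1 := Int.sign_eq_neg_one_of_neg (by omega)
      have hb : x.beq y = false := Bool.eq_false_iff.2 fun h' => h.ne' (Nat.eq_of_beq_eq_true h')
      have hle : x.ble y = false :=
        Bool.eq_false_iff.2 fun h' => h.not_ge (Nat.le_of_ble_eq_true h')
      simp [inversionSign, hb, hle, this, ih]

theorem listSign_ofFn {n : ℕ} (f : Fin n → ℕ) :
    listSign (List.ofFn f) = ∏ i, ∏ j ∈ Finset.Ioi i, ((f j : ℤ) - f i).sign := by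
  induction n with
  | zero => simp [listSign]
  | succ n ih =>
    simp [List.ofFn_succ, listSign, inversionSign_eq, ih, Fin.prod_univ_succ, Fin.prod_Ioi_succ,
      List.prod_ofFn, Function.comp_def]

theorem det_single_eq_listSign {n : ℕ} (f : Fin n → Fin n) :
    (Matrix.of fun a b => if a = f b then (1 : ℝ) else 0).det =
      listSign (List.ofFn fun i => (f i : ℕ)) := by
  rw [listSign_ofFn]
  by_cases hf : Function.Injective f
  · let σ : Equiv.Perm (Fin n) := Equiv.ofBijective f (Finite.injective_iff_bijective.1 hf)
    have hσ : (Matrix.of fun a b => if a = f b then (1 : ℝ) else 0) =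
        (σ.toPEquiv.toMatrix : Matrix (Fin n) (Fin n) ℝ)ᵀ := by
      ext a b
      simp [PEquiv.toMatrix_apply, σ, eq_comm]
    rw [hσ, Matrix.det_transpose, Matrix.det_permutation, Equiv.Perm.sign_eq_prod_prod_Ioi]
    push_cast
    refine Finset.prod_congr rfl fun i _ => Finset.prod_congr rfl fun j hj => ?_
    have hne : f i ≠ f j := hf.ne (Finset.mem_Ioi.1 hj).ne
    rcases lt_or_gt_of_ne hne with h | h
    · have : ((f j : ℕ) - (f i : ℕ) : ℤ).sign = 1 := Int.sign_eq_one_of_pos (by omega)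
      simp [σ, h, this]
    · have : ((f j : ℕ) - (f i : ℕ) : ℤ).sign = -1 := Int.sign_eq_neg_one_of_neg (by omega)
      simp [σ, h.not_gt, this]
  · obtain ⟨i, j, hij, hne⟩ := Function.not_injective_iff.1 hf
    wlog hlt : i < j generalizing i j
    · exact this j i hij.symm hne.symm (lt_of_le_of_ne (not_lt.1 hlt) hne.symm)
    rw [Matrix.det_zero_of_column_eq hne (by simp [hij]),
      Finset.prod_eq_zero (Finset.mem_univ i)
        (Finset.prod_eq_zero (Finset.mem_Ioi.2 hlt) (by simp [hij])), Int.cast_zero]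

theorem elemForm_apply_e {k : ℕ} (f g : Fin k → Fin 8) {v : Fin k → V}
    (hv : ∀ a, v a = e (g a)) :
    elemForm f v = (Matrix.of fun a b => if g a = f b then (1 : ℝ) else 0).det := by
  simp_rw [elemForm_apply, hv, e_apply]

theorem elemForm_apply_basis {n : ℕ} (hn : n = 8) (f : Fin n → Fin 8) {v : Fin n → V}
    (hv : ∀ a, v a = e (Fin.cast hn a)) :
    elemForm f v = listSign (List.ofFn fun i => (f i : ℕ)) := by
  subst hn
  rw [elemForm_apply_e f _ hv]
  exact det_single_eq_listSign f

theorem detRowAlternating_eq_det {k : ℕ} (v : Fin k → Fin k → ℝ) :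
    Matrix.detRowAlternating v = (Matrix.of v).det := rfl

theorem vol₀_apply_basis : vol₀ e = 1 := by
  have h : Matrix.of e = (1 : Matrix (Fin 8) (Fin 8) ℝ) := by
    ext a b
    simp [e_apply, Matrix.one_apply]
  rw [vol₀, detRowAlternating_eq_det, h, Matrix.det_one]

theorem smul_vol₀_apply_basis (c : ℝ) : (c • vol₀) e = c := by
  rw [AlternatingMap.smul_apply, vol₀_apply_basis, smul_eq_mul, mul_one]

theorem cayleySum_eq (F : ℤ → ℕ → ℕ → ℕ → ℕ → ℤ → ℤ) (f : Fin 8 → Fin 8 → Fin 8 → Fin 8 → ℤ)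
    (h : ∀ (s : ℤ) (a b c d : Fin 8) (acc : ℤ), F s a b c d acc = s * f a b c d + acc) :
    cayleySum F = f 0 1 2 3 + f 0 1 4 5 + f 0 1 6 7 + f 0 2 4 6 - f 0 2 5 7 - f 0 3 4 7
      - f 0 3 5 6 + f 4 5 6 7 + f 2 3 6 7 + f 2 3 4 5 + f 1 3 5 7 - f 1 3 4 6 - f 1 2 5 6
      - f 1 2 4 7 := by
  have h' (s : ℤ) (a b c d : ℕ) (acc : ℤ) (ha : a < 8) (hb : b < 8) (hc : c < 8) (hd : d < 8) :
      F s a b c d acc =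
        s * f (Fin.ofNat 8 a) (Fin.ofNat 8 b) (Fin.ofNat 8 c) (Fin.ofNat 8 d) + acc := by
    simpa [Nat.mod_eq_of_lt, *] using
      h s (Fin.ofNat 8 a) (Fin.ofNat 8 b) (Fin.ofNat 8 c) (Fin.ofNat 8 d) acc
  simp [cayleySum, h', -Fin.ofNat_eq_cast]
  ring

theorem delta₄_eq (i j k l : ℕ) (s : ℤ) (a b c d : ℕ) (acc : ℤ) :
    delta₄ i j k l s a b c d acc = s * delta₄ i j k l 1 a b c d 0 + acc := by
  simp only [delta₄, addIf_eq]
  split_ifs <;> ring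

theorem cast_addIf (i a : Fin 8) (r acc : ℤ) :
    (addIf i a r acc : ℝ) = e i a * r + acc := by
  simp [addIf_eq, e_apply, Fin.val_inj]

theorem E4_apply_e (a b c d i j k l : Fin 8) :
    E4 a b c d ![e i, e j, e k, e l] = delta₄ i j k l 1 a b c d 0 := by
  have h : E4 a b c d ![e i, e j, e k, e l] =
      Matrix.det (Matrix.of fun r t => ![e i, e j, e k, e l] r (![a, b, c, d] t)) := rfl
  rw [h, Matrix.det_succ_row_zero]
  simp only [delta₄, delta₃, delta₂, cast_addIf, Int.cast_mul, Int.cast_neg, Int.cast_one,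
    Int.cast_zero]
  simp [Fin.sum_univ_succ, Matrix.det_fin_three, Fin.succAbove]
  ring

section KernelComputations

set_option maxRecDepth 100000

theorem all8_cayleyCoeff_eq_cayleySum_delta₄ :
    all8 fun i => all8 fun j => all8 fun k => all8 fun l =>
      cayleyCoeff i j k l = cayleySum (delta₄ i j k l) := by
  decide +kernel

theorem all8_cayleySum_contractAdd :
    all8 fun p => all8 fun i => all8 fun m => all8 fun n =>
      cayleySum (contractAdd p i m n) =
        addIf m p (addIf n i 4 0) (addIf p i (addIf m n 3 0) (2 * cayleyCoeff m n p i)) := by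
  decide +kernel

theorem all8_projSum :
    all8 fun i => all8 fun j => all8 fun k => all8 fun l =>
      bif i.blt j && j.blt k && k.blt l then
        all8 fun m => all8 fun n =>
          3 * (diamondCoeff i j k l m n - diamondCoeff i j k l n m) = projSum i j k l m n
      else true := by
  decide +kernel

theorem all8_cayleyCoeff_eq_cayleySum_listSign :
    all8 fun k => all8 fun l =>
      bif k.blt l then
        all8 fun i => all8 fun j =>
          cayleyCoeff i j k l =
            cayleySum fun s a b c d acc => s * listSign [i, j, k, l, a, b, c, d] + acc
      else true := by
  decide +kernel

end KernelComputations

theorem cayleyCoeff_eq_cayleySum_delta₄ (i j k l : Fin 8) :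
    cayleyCoeff i j k l = cayleySum (delta₄ i j k l) := by
  have h := all8_cayleyCoeff_eq_cayleySum_delta₄
  simp only [all8_iff, decide_eq_true_eq] at h
  exact h i j k l

theorem cayleySum_contractAdd (p i m n : Fin 8) :
    cayleySum (contractAdd p i m n) =
      addIf m p (addIf n i 4 0) (addIf p i (addIf m n 3 0) (2 * cayleyCoeff m n p i)) := by
  have h := all8_cayleySum_contractAdd
  simp only [all8_iff, decide_eq_true_eq] at h
  exact h p i m n

theorem projSum_eq {i j k l : Fin 8} (hij : i < j) (hjk : j < k) (hkl : k < l) (m n : Fin 8) :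
    3 * (diamondCoeff i j k l m n - diamondCoeff i j k l n m) = projSum i j k l m n := by
  have h := all8_projSum
  simp only [all8_iff] at h
  have h := h i j k l
  have h1 : (i : ℕ).blt j = true := by simpa using hij
  have h2 : (j : ℕ).blt k = true := by simpa using hjk
  have h3 : (k : ℕ).blt l = true := by simpa using hkl
  simp only [h1, h2, h3, Bool.and_true, cond_true, all8_iff, decide_eq_true_eq] at h
  exact h m n

theorem cayleyCoeff_eq_cayleySum_listSign (i j : Fin 8) {k l : Fin 8} (hkl : k < l) :
    cayleyCoeff i j k l =
      cayleySum fun s a b c d acc => s * listSign [(i : ℕ), j, k, l, a, b, c, d] + acc := by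
  have h := all8_cayleyCoeff_eq_cayleySum_listSign
  simp only [all8_iff] at h
  have h := h k l
  have h1 : (k : ℕ).blt l = true := by simpa using hkl
  simp only [h1, cond_true, all8_iff, decide_eq_true_eq] at h
  exact h i j

theorem Φ₀_apply_e (i j k l : Fin 8) :
    Φ₀ ![e i, e j, e k, e l] = cayleyCoeff i j k l := by
  rw [cayleyCoeff_eq_cayleySum_delta₄,
    cayleySum_eq _ _ fun s a b c d => delta₄_eq i j k l s a b c d]
  push_cast
  simp only [Φ₀, AlternatingMap.add_apply, AlternatingMap.sub_apply, E4_apply_e]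

/-- Expansion of an alternating form in one of its arguments. -/
theorem form_update_eq_sum {k : ℕ} (f : Form k) (v : Fin k → V) (t : Fin k) (x : V) :
    f (Function.update v t x) = ∑ m, x m * f (Function.update v t (e m)) := by
  have hx : x = ∑ m, x m • e m := by
    simpa [e] using ((Pi.basisFun ℝ (Fin 8)).sum_repr x).symm
  conv_lhs => rw [hx]
  simp [AlternatingMap.map_update_sum, AlternatingMap.map_update_smul]

theorem sum_mul_diamondCoeff (g : Fin 8 → Fin 8 → ℝ) (i j k l : Fin 8) :
    ∑ m, ∑ n, g m n * diamondCoeff i j k l m n =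
      ∑ m : Fin 8, (g m i * cayleyCoeff m j k l + g m j * cayleyCoeff i m k l +
        g m k * cayleyCoeff i j m l + g m l * cayleyCoeff i j k m) := by
  refine Finset.sum_congr rfl fun m _ => ?_
  simp [diamondCoeff, addIf_eq, mul_add, Finset.sum_add_distrib, Fin.val_inj, add_assoc]

theorem diamond_apply_e (A : V →ₗ[ℝ] V) (i j k l : Fin 8) :
    Φ₀ ![A (e i), e j, e k, e l] + Φ₀ ![e i, A (e j), e k, e l] +
        Φ₀ ![e i, e j, A (e k), e l] + Φ₀ ![e i, e j, e k, A (e l)] =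
      ∑ m, ∑ n, A (e n) m * diamondCoeff i j k l m n := by
  have h0 (x : V) : Φ₀ ![x, e j, e k, e l] = ∑ m, x m * cayleyCoeff m j k l := by
    have hv (y : V) : ![y, e j, e k, e l] = Function.update ![0, e j, e k, e l] 0 y := by
      ext t : 1; fin_cases t <;> rfl
    rw [hv, form_update_eq_sum]
    simp_rw [← hv, Φ₀_apply_e]
  have h1 (x : V) : Φ₀ ![e i, x, e k, e l] = ∑ m, x m * cayleyCoeff i m k l := by
    have hv (y : V) : ![e i, y, e k, e l] = Function.update ![e i, 0, e k, e l] 1 y := by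
      ext t : 1; fin_cases t <;> rfl
    rw [hv, form_update_eq_sum]
    simp_rw [← hv, Φ₀_apply_e]
  have h2 (x : V) : Φ₀ ![e i, e j, x, e l] = ∑ m, x m * cayleyCoeff i j m l := by
    have hv (y : V) : ![e i, e j, y, e l] = Function.update ![e i, e j, 0, e l] 2 y := by
      ext t : 1; fin_cases t <;> rfl
    rw [hv, form_update_eq_sum]
    simp_rw [← hv, Φ₀_apply_e]
  have h3 (x : V) : Φ₀ ![e i, e j, e k, x] = ∑ m, x m * cayleyCoeff i j k m := by
    have hv (y : V) : ![e i, e j, e k, y] = Function.update ![e i, e j, e k, 0] 3 y := by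
      ext t : 1; fin_cases t <;> rfl
    rw [hv, form_update_eq_sum]
    simp_rw [← hv, Φ₀_apply_e]
  rw [sum_mul_diamondCoeff fun m n => A (e n) m, h0, h1, h2, h3]
  simp only [Finset.sum_add_distrib]

theorem sum_mul_addIf_eq_zero {a : Fin 8 → Fin 8 → ℝ} {x y : ℕ} {s : ℤ}
    {r acc : Fin 8 → Fin 8 → ℤ} (hr : ∑ m, ∑ n, a m n * r m n = 0)
    (hacc : ∑ m, ∑ n, a m n * acc m n = 0) :
    ∑ m, ∑ n, a m n * (addIf x y (s * r m n) (acc m n) : ℤ) = 0 := by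
  by_cases h : x = y
  · simp only [addIf_eq, h, if_true, Int.cast_add, Int.cast_mul, mul_add, mul_left_comm _ (s : ℝ),
      Finset.sum_add_distrib, ← Finset.mul_sum, hr, hacc, mul_zero, add_zero]
  · simpa [addIf_eq, h] using hacc

theorem contraction_eq_zero {a : Fin 8 → Fin 8 → ℝ}
    (ha : ∀ i j k l : Fin 8, ∑ m, ∑ n, a m n * diamondCoeff i j k l m n = 0) (p i : Fin 8) :
    4 * a p i + 3 * (if p = i then ∑ m, a m m else 0) +
      2 * ∑ m : Fin 8, ∑ n : Fin 8, a m n * cayleyCoeff m n p i = 0 := by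
  have hc (b c d f : Fin 8) :
      ∑ m : Fin 8, ∑ n : Fin 8, a m n * (contractAdd p i m n 1 b c d f 0 : ℤ) = 0 :=
    sum_mul_addIf_eq_zero (ha i c d f) <| sum_mul_addIf_eq_zero (ha i b d f) <|
      sum_mul_addIf_eq_zero (ha i b c f) <| sum_mul_addIf_eq_zero (ha i b c d) <| by simp
  have hsum : ∑ m : Fin 8, ∑ n : Fin 8, a m n * (cayleySum (contractAdd p i m n) : ℤ) = 0 := by
    have hf (m n : Fin 8) (s : ℤ) (b c d f : Fin 8) (acc : ℤ) : contractAdd p i m n s b c d f acc =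
        s * contractAdd p i m n 1 b c d f 0 + acc := by
      simp only [contractAdd, addIf_eq]
      split_ifs <;> ring
    simp_rw [fun m n => cayleySum_eq _ _ (hf m n)]
    push_cast
    simp only [mul_add, mul_sub, Finset.sum_add_distrib, Finset.sum_sub_distrib]
    linear_combination hc 0 1 2 3 + hc 0 1 4 5 + hc 0 1 6 7 + hc 0 2 4 6 - hc 0 2 5 7
      - hc 0 3 4 7 - hc 0 3 5 6 + hc 4 5 6 7 + hc 2 3 6 7 + hc 2 3 4 5 + hc 1 3 5 7
      - hc 1 3 4 6 - hc 1 2 5 6 - hc 1 2 4 7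
  simp only [cayleySum_contractAdd, addIf_eq, Fin.val_inj] at hsum
  refine Eq.trans ?_ hsum
  by_cases h : p = i <;>
    simp only [h, if_true, if_false, add_zero, zero_add, mul_zero] <;> push_cast <;>
    simp [mul_add, Finset.sum_add_distrib, mul_left_comm _ (2 : ℝ), ← Finset.mul_sum,
      mul_comm _ (3 : ℝ), mul_comm _ (4 : ℝ), add_assoc]

theorem addIf_xor_cayleyCoeff (i j k l : ℕ) (r acc : ℤ) :
    addIf ((i.xor j).xor (k.xor l)) 0 (cayleyCoeff i j k l * r) acc =
      cayleyCoeff i j k l * r + acc := by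
  rw [cayleyCoeff, addIf_eq, addIf_eq]
  split_ifs <;> simp only [add_zero, zero_mul]

theorem projSum_eq_sum (i j k l m n : ℕ) :
    projSum i j k l m n = ∑ x : Fin 8,
      (cayleyCoeff m n x i * cayleyCoeff x j k l + cayleyCoeff m n x j * cayleyCoeff i x k l +
        cayleyCoeff m n x k * cayleyCoeff i j x l + cayleyCoeff m n x l * cayleyCoeff i j k x) := by
  simp only [projSum, projAdd, addIf_xor_cayleyCoeff, Fin.sum_univ_eight, Fin.isValue,
    Fin.coe_ofNat_eq_mod, Nat.reduceMod]
  ring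

/-- Eight times the projection of a matrix onto the kernel of the diamond operator. -/
def kernelProj (a : Fin 8 → Fin 8 → ℝ) (x y : Fin 8) : ℝ :=
  3 * (a x y - a y x) - ∑ m : Fin 8, ∑ n : Fin 8, a m n * cayleyCoeff m n x y

theorem sum_kernelProj_mul_diamondCoeff (a : Fin 8 → Fin 8 → ℝ) {i j k l : Fin 8}
    (hij : i < j) (hjk : j < k) (hkl : k < l) :
    ∑ x, ∑ y, kernelProj a x y * diamondCoeff i j k l x y = 0 := by
  have h (m n : Fin 8) : ∑ x : Fin 8, ∑ y : Fin 8,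
      (cayleyCoeff m n x y : ℝ) * diamondCoeff i j k l x y =
        3 * (diamondCoeff i j k l m n - diamondCoeff i j k l n m) := by
    rw [sum_mul_diamondCoeff fun x y => (cayleyCoeff m n x y : ℝ)]
    exact_mod_cast ((projSum_eq hij hjk hkl m n).trans (projSum_eq_sum ..)).symm
  have h1 : ∑ x : Fin 8, ∑ y : Fin 8, (∑ m : Fin 8, ∑ n : Fin 8, a m n * cayleyCoeff m n x y) *
      diamondCoeff i j k l x y =
        ∑ m, ∑ n, a m n * (3 * (diamondCoeff i j k l m n - diamondCoeff i j k l n m)) := by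
    simp_rw [← h, Finset.mul_sum, Finset.sum_mul, ← Fintype.sum_prod_type']
    exact Fintype.sum_equiv
      ⟨fun x => (x.2.2.1, x.2.2.2, x.1, x.2.1), fun x => (x.2.2.1, x.2.2.2, x.1, x.2.1),
        fun _ => rfl, fun _ => rfl⟩ _ _ fun _ => mul_assoc _ _ _
  have h2 : ∑ x : Fin 8, ∑ y : Fin 8, a y x * diamondCoeff i j k l x y =
      ∑ x : Fin 8, ∑ y : Fin 8, a x y * (diamondCoeff i j k l y x : ℝ) :=
    Finset.sum_comm
  simp only [kernelProj, sub_mul, Finset.sum_sub_distrib, h1, mul_sub, mul_assoc,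
    mul_left_comm _ (3 : ℝ), ← Finset.mul_sum, h2, sub_self]

theorem wedge_Φ₀ {k : ℕ} (ω : Form k) :
    wedge ω Φ₀ = wedge ω (E4 0 1 2 3) + wedge ω (E4 0 1 4 5) + wedge ω (E4 0 1 6 7)
      + wedge ω (E4 0 2 4 6) - wedge ω (E4 0 2 5 7) - wedge ω (E4 0 3 4 7)
      - wedge ω (E4 0 3 5 6) + wedge ω (E4 4 5 6 7) + wedge ω (E4 2 3 6 7)
      + wedge ω (E4 2 3 4 5) + wedge ω (E4 1 3 5 7) - wedge ω (E4 1 3 4 6)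
      - wedge ω (E4 1 2 5 6) - wedge ω (E4 1 2 4 7) := by
  change wedgeBilin k 4 ω Φ₀ = _
  simp only [Φ₀, map_add, map_sub]
  rfl

theorem wedge_wedge_E4_apply_basis (i j k l a b c d : Fin 8) :
    wedge (wedge (elemForm ![i, j]) (elemForm ![k, l])) (E4 a b c d) e =
      listSign [(i : ℕ), j, k, l, a, b, c, d] := by
  have h : E4 a b c d = elemForm ![a, b, c, d] := rfl
  rw [h, wedge_elemForm, wedge_elemForm]
  rw [elemForm_apply_basis rfl _ (v := e) fun _ => rfl]
  congr 1

theorem wedge_wedge_Φ₀_apply_basis (i j : Fin 8) {k l : Fin 8} (hkl : k < l) :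
    wedge (wedge (elemForm ![i, j]) (elemForm ![k, l])) Φ₀ e = cayleyCoeff i j k l := by
  rw [cayleyCoeff_eq_cayleySum_listSign i j hkl, cayleySum_eq _
    (fun a b c d => listSign [(i : ℕ), j, k, l, a, b, c, d]) fun s a b c d acc => rfl, wedge_Φ₀]
  push_cast
  simp only [AlternatingMap.add_apply, AlternatingMap.sub_apply, wedge_wedge_E4_apply_basis]

theorem wedge_wedge_Φ₀_eq_sum (α β : Form 2) :
    wedge (wedge α β) Φ₀ =
      ∑ i, ∑ j, (α ![e i, e j] / 2) • wedge (wedge (elemForm ![i, j]) β) Φ₀ := by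
  conv_lhs => rw [form_two_eq_sum α]
  simp only [← wedgeBilin_apply, map_sum, map_smul, LinearMap.sum_apply, LinearMap.smul_apply]

theorem map_apply_eq_sum {M : Form 2 →ₗ[ℝ] Form 2}
    (hM : ∀ α β : Form 2, wedge (wedge α β) Φ₀ = formInner (M α) β • vol₀)
    (α : Form 2) {k l : Fin 8} (hkl : k < l) :
    M α ![e k, e l] = ∑ i, ∑ j, α ![e i, e j] / 2 * cayleyCoeff i j k l := by
  have h : wedge (wedge α (elemForm ![k, l])) Φ₀ e = M α ![e k, e l] := by
    rw [hM, formInner_elemForm_pair _ hkl]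
    exact smul_vol₀_apply_basis _
  rw [← h, wedge_wedge_Φ₀_eq_sum]
  simp only [Form.sum_apply, AlternatingMap.smul_apply, smul_eq_mul,
    wedge_wedge_Φ₀_apply_basis _ _ hkl]

theorem cayleyCoeff_swap (i j k l : Fin 8) :
    (cayleyCoeff i j l k : ℝ) = -cayleyCoeff i j k l := by
  rw [← Φ₀_apply_e, ← Φ₀_apply_e, ← Φ₀.map_swap _ (show (2 : Fin 4) ≠ 3 by decide)]
  congr 1
  ext t : 1
  fin_cases t <;> rfl

theorem cayleyCoeff_self (i j : Fin 8) : (cayleyCoeff i j i j : ℝ) = 0 := by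
  rw [← Φ₀_apply_e]
  exact Φ₀.map_eq_zero_of_eq ![e i, e j, e i, e j] (i := 0) (j := 2) rfl (by decide)

/-- The matrices of skew endomorphisms whose 2-form is a `-1`-eigenvector of `M`. -/
def IsEigenSkew (a : Fin 8 → Fin 8 → ℝ) : Prop :=
  (∀ x y, a y x = -a x y) ∧
    ∀ x y : Fin 8, ∑ m : Fin 8, ∑ n : Fin 8, a m n * cayleyCoeff m n x y = -2 * a x y

theorem sum_mul_cayleyCoeff_swap (a : Fin 8 → Fin 8 → ℝ) (x y : Fin 8) :
    ∑ m : Fin 8, ∑ n : Fin 8, a m n * (cayleyCoeff m n y x : ℝ) =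
      -∑ m : Fin 8, ∑ n : Fin 8, a m n * cayleyCoeff m n x y := by
  simp only [cayleyCoeff_swap _ _ x y, mul_neg, Finset.sum_neg_distrib]

theorem isEigenSkew_of_lt {a : Fin 8 → Fin 8 → ℝ} (hskew : ∀ x y, a y x = -a x y)
    (h : ∀ x y : Fin 8, x < y →
      ∑ m : Fin 8, ∑ n : Fin 8, a m n * cayleyCoeff m n x y = -2 * a x y) : IsEigenSkew a := by
  refine ⟨hskew, fun x y => ?_⟩
  rcases lt_trichotomy x y with hxy | rfl | hxy
  · exact h x y hxy
  · linarith [sum_mul_cayleyCoeff_swap a x x, hskew x x]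
  · linarith [sum_mul_cayleyCoeff_swap a y x, hskew x y, h y x hxy]

theorem isEigenSkew_of_sum_mul_diamondCoeff {a : Fin 8 → Fin 8 → ℝ}
    (ha : ∀ i j k l : Fin 8, ∑ m, ∑ n, a m n * diamondCoeff i j k l m n = 0) :
    IsEigenSkew a := by
  have hdiag (p : Fin 8) : 4 * a p p + 3 * ∑ m, a m m = 0 := by
    have h := contraction_eq_zero ha p p
    rw [if_pos rfl] at h
    linarith [sum_mul_cayleyCoeff_swap a p p]
  have htr : ∑ m, a m m = 0 := by
    have h := Finset.sum_eq_zero fun p (_ : p ∈ Finset.univ) => hdiag p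
    rw [Finset.sum_add_distrib, ← Finset.mul_sum, Finset.sum_const, Finset.card_univ,
      Fintype.card_fin, nsmul_eq_mul] at h
    push_cast at h
    linarith
  have hsum (x y : Fin 8) :
      ∑ m : Fin 8, ∑ n : Fin 8, a m n * cayleyCoeff m n x y = -2 * a x y := by
    have h := contraction_eq_zero ha x y
    rw [htr, ite_self] at h
    linarith
  exact ⟨fun x y => by linarith [sum_mul_cayleyCoeff_swap a x y, hsum x y, hsum y x], hsum⟩

theorem IsEigenSkew.kernelProj_eq {a : Fin 8 → Fin 8 → ℝ} (ha : IsEigenSkew a) (x y : Fin 8) :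
    kernelProj a x y = 8 * a x y := by
  rw [kernelProj, ha.2, ha.1 x y]
  ring

/-- The projection of matrices onto the kernel of the diamond operator. -/
def kernelProjection : Matrix (Fin 8) (Fin 8) ℝ →ₗ[ℝ] Matrix (Fin 8) (Fin 8) ℝ where
  toFun a := Matrix.of fun x y => kernelProj a x y / 8
  map_add' a b := by
    ext x y
    simp only [kernelProj, Matrix.add_apply, Matrix.of_apply, add_mul, Finset.sum_add_distrib]
    ring
  map_smul' c a := by
    ext x y
    simp only [kernelProj, Matrix.smul_apply, Matrix.of_apply, smul_eq_mul, mul_assoc,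
      ← Finset.mul_sum, RingHom.id_apply]
    ring

theorem kernelProjection_apply (a : Matrix (Fin 8) (Fin 8) ℝ) (x y : Fin 8) :
    kernelProjection a x y = kernelProj a x y / 8 := rfl

theorem trace_kernelProjection : LinearMap.trace ℝ _ kernelProjection = 21 := by
  rw [LinearMap.trace_eq_matrix_trace ℝ (Matrix.stdBasis ℝ (Fin 8) (Fin 8))]
  have hdiag (m n : Fin 8) : kernelProj (Matrix.single m n 1) m n =
      3 * (1 - if m = n then 1 else 0) := by
    have h : ∑ x : Fin 8, ∑ y : Fin 8,
        (Matrix.single m n 1 : Matrix (Fin 8) (Fin 8) ℝ) x y * cayleyCoeff x y m n = 0 := by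
      simp [Matrix.single_apply, ite_and, cayleyCoeff_self]
    unfold kernelProj
    rw [h, sub_zero]
    simp [Matrix.single_apply, eq_comm]
  have hrepr (a : Matrix (Fin 8) (Fin 8) ℝ) (p : Fin 8 × Fin 8) :
      (Matrix.stdBasis ℝ (Fin 8) (Fin 8)).repr a p = a p.1 p.2 := by
    rfl
  simp only [Matrix.trace, Matrix.diag_apply, LinearMap.toMatrix_apply, hrepr,
    Fintype.sum_prod_type, Matrix.stdBasis_eq_single, kernelProjection_apply, hdiag]
  simp [← Finset.sum_div, ← Finset.mul_sum]
  norm_num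

theorem map_apply_e {D : (V →ₗ[ℝ] V) →ₗ[ℝ] Form 4}
    (hD : ∀ (A : V →ₗ[ℝ] V) (x y z w : V),
      D A ![x, y, z, w] =
        Φ₀ ![A x, y, z, w] + Φ₀ ![x, A y, z, w] + Φ₀ ![x, y, A z, w] + Φ₀ ![x, y, z, A w])
    (A : V →ₗ[ℝ] V) (i j k l : Fin 8) :
    D A ![e i, e j, e k, e l] = ∑ m, ∑ n, A (e n) m * diamondCoeff i j k l m n := by
  rw [hD, diamond_apply_e]

theorem isEigenSkew_of_mem_ker {D : (V →ₗ[ℝ] V) →ₗ[ℝ] Form 4}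
    (hD : ∀ (A : V →ₗ[ℝ] V) (x y z w : V),
      D A ![x, y, z, w] =
        Φ₀ ![A x, y, z, w] + Φ₀ ![x, A y, z, w] + Φ₀ ![x, y, A z, w] + Φ₀ ![x, y, z, A w])
    {A : V →ₗ[ℝ] V} (hA : A ∈ LinearMap.ker D) : IsEigenSkew fun m n => A (e n) m := by
  refine isEigenSkew_of_sum_mul_diamondCoeff fun i j k l => ?_
  rw [← map_apply_e hD, LinearMap.mem_ker.1 hA, AlternatingMap.zero_apply]

theorem mem_ker_of_eq_kernelProj {D : (V →ₗ[ℝ] V) →ₗ[ℝ] Form 4}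
    (hD : ∀ (A : V →ₗ[ℝ] V) (x y z w : V),
      D A ![x, y, z, w] =
        Φ₀ ![A x, y, z, w] + Φ₀ ![x, A y, z, w] + Φ₀ ![x, y, A z, w] + Φ₀ ![x, y, z, A w])
    {A : V →ₗ[ℝ] V} (a : Fin 8 → Fin 8 → ℝ) (hA : ∀ m n, A (e n) m = kernelProj a m n / 8) :
    A ∈ LinearMap.ker D := by
  refine LinearMap.mem_ker.2 (form_ext_strictMono fun v hv => ?_)
  have hvec : (fun t => e (v t)) = ![e (v 0), e (v 1), e (v 2), e (v 3)] := by
    ext t : 1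
    fin_cases t <;> rfl
  have hzero := sum_kernelProj_mul_diamondCoeff a
    (hv (show (0 : Fin 4) < 1 by decide)) (hv (show (1 : Fin 4) < 2 by decide))
    (hv (show (2 : Fin 4) < 3 by decide))
  rw [hvec, map_apply_e hD, AlternatingMap.zero_apply]
  simp only [hA, div_mul_eq_mul_div, ← Finset.sum_div, hzero, zero_div]

theorem mem_ker_iff {D : (V →ₗ[ℝ] V) →ₗ[ℝ] Form 4}
    (hD : ∀ (A : V →ₗ[ℝ] V) (x y z w : V),
      D A ![x, y, z, w] =
        Φ₀ ![A x, y, z, w] + Φ₀ ![x, A y, z, w] + Φ₀ ![x, y, A z, w] + Φ₀ ![x, y, z, A w])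
    (A : V →ₗ[ℝ] V) :
    A ∈ LinearMap.ker D ↔ IsEigenSkew fun m n => A (e n) m :=
  ⟨isEigenSkew_of_mem_ker hD, fun h => mem_ker_of_eq_kernelProj hD _ fun m n => by
    rw [h.kernelProj_eq, mul_div_cancel_left₀ _ (by norm_num : (8 : ℝ) ≠ 0)]⟩

theorem finrank_ker {D : (V →ₗ[ℝ] V) →ₗ[ℝ] Form 4}
    (hD : ∀ (A : V →ₗ[ℝ] V) (x y z w : V),
      D A ![x, y, z, w] =
        Φ₀ ![A x, y, z, w] + Φ₀ ![x, A y, z, w] + Φ₀ ![x, y, A z, w] + Φ₀ ![x, y, z, A w]) :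
    Module.finrank ℝ (LinearMap.ker D) = 21 := by
  let K := (LinearMap.ker D).map (LinearMap.toMatrix' : (V →ₗ[ℝ] V) ≃ₗ[ℝ] _).toLinearMap
  have hproj : LinearMap.IsProj K kernelProjection := by
    refine ⟨fun a => ?_, fun a ha => ?_⟩
    · refine (Submodule.mem_map_equiv _).2 (mem_ker_of_eq_kernelProj hD a fun m n => ?_)
      simp [e, kernelProjection_apply]
    · have h : IsEigenSkew a := by
        simpa [e] using isEigenSkew_of_mem_ker hD ((Submodule.mem_map_equiv _).1 ha)
      ext x y
      rw [kernelProjection_apply, h.kernelProj_eq]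
      ring
  have hfin : (Module.finrank ℝ K : ℝ) = 21 := by
    rw [← hproj.trace, trace_kernelProjection]
  rw [← LinearEquiv.finrank_map_eq LinearMap.toMatrix' (LinearMap.ker D)]
  exact_mod_cast hfin

/-- The 2-form `(x, y) ↦ ⟨A x, y⟩` of a skew-adjoint endomorphism. -/
def skewForm (A : V →ₗ[ℝ] V) (hA : ∀ x y : V, A x ⬝ᵥ y = -(x ⬝ᵥ A y)) : Form 2 where
  toFun v := A (v 0) ⬝ᵥ v 1
  map_update_add' v i x y := by
    fin_cases i <;> simp
  map_update_smul' v i c x := by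
    fin_cases i <;> simp
  map_eq_zero_of_eq' v i j h hij := by
    have h01 : v 0 = v 1 := by
      fin_cases i <;> fin_cases j <;> simp_all
    have h := hA (v 0) (v 1)
    rw [← h01, dotProduct_comm (v 0) (A (v 0))] at h
    rw [← h01]
    linarith

theorem dotProduct_e (x : V) (i : Fin 8) : x ⬝ᵥ e i = x i := by
  simp [e]

theorem skew_iff (A : V →ₗ[ℝ] V) :
    (∀ x y : V, A x ⬝ᵥ y = -(x ⬝ᵥ A y)) ↔ ∀ i j, A (e i) j = -A (e j) i := by
  constructor
  · intro h i j
    rw [← dotProduct_e (A (e i)) j, h, dotProduct_comm, dotProduct_e]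
  · intro h x y
    have hx (x : V) (m : Fin 8) : A x m = ∑ n, x n * A (e n) m := by
      have hx : x = ∑ n, x n • e n := by
        simpa [e] using ((Pi.basisFun ℝ (Fin 8)).sum_repr x).symm
      conv_lhs => rw [hx]
      simp
    simp only [dotProduct, hx x, hx y, Finset.sum_mul, Finset.mul_sum, ← Finset.sum_neg_distrib]
    rw [Finset.sum_comm]
    refine Finset.sum_congr rfl fun i _ => Finset.sum_congr rfl fun j _ => ?_
    rw [h i j]
    ring

theorem map_eq_neg_iff {M : Form 2 →ₗ[ℝ] Form 2}
    (hM : ∀ α β : Form 2, wedge (wedge α β) Φ₀ = formInner (M α) β • vol₀)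
    {A : V →ₗ[ℝ] V} (hA : ∀ i j, A (e i) j = -A (e j) i) {α : Form 2}
    (hα : ∀ x y : V, α ![x, y] = A x ⬝ᵥ y) :
    M α = -α ↔ IsEigenSkew fun m n => A (e n) m := by
  have hαe (i j : Fin 8) : α ![e i, e j] = A (e i) j := by
    rw [hα, dotProduct_e]
  have key {k l : Fin 8} (hkl : k < l) : M α ![e k, e l] =
      -(∑ i : Fin 8, ∑ j : Fin 8, A (e j) i * cayleyCoeff i j k l) / 2 := by
    rw [map_apply_eq_sum hM α hkl, neg_div, Finset.sum_div, ← Finset.sum_neg_distrib]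
    refine Finset.sum_congr rfl fun i _ => ?_
    rw [Finset.sum_div, ← Finset.sum_neg_distrib]
    refine Finset.sum_congr rfl fun j _ => ?_
    rw [hαe, hA]
    ring
  constructor
  · intro h
    refine isEigenSkew_of_lt (fun x y => hA x y) fun x y hxy => ?_
    have h := key hxy
    rw [‹M α = -α›, AlternatingMap.neg_apply, hαe, hA] at h
    linarith
  · intro h
    refine form_ext_strictMono fun v hv => ?_
    have hvec : (fun t => e (v t)) = ![e (v 0), e (v 1)] := by
      ext t : 1
      fin_cases t <;> rfl
    rw [hvec, key (hv (show (0 : Fin 2) < 1 by decide)), h.2, AlternatingMap.neg_apply, hαe, hA]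
    ring

/-- **Kernel of the infinitesimal action `A ↦ A⋄Φ₀` (Proposition 2.10):** the kernel of
the linear map `A ↦ A⋄Φ₀`, from the 64-dimensional space of endomorphisms of `ℝ⁸` to the
alternating 4-forms, is exactly the set of skew-adjoint endomorphisms `A` whose associated
2-form `α_A(x,y) = ⟨Ax, y⟩` lies in `Λ²₂₁ = ker(M + id)`; in particular this kernel has
dimension 21. Here `D` is the map `A ↦ A⋄Φ₀`, characterised by `hD`, and `M` is the unique
endomorphism of 2-forms with `α∧β∧Φ₀ = ⟨Mα, β⟩·vol₀`. -/
theorem diamond_kernel (M : Form 2 →ₗ[ℝ] Form 2)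
    (hM : ∀ α β : Form 2, wedge (wedge α β) Φ₀ = formInner (M α) β • vol₀)
    (D : (V →ₗ[ℝ] V) →ₗ[ℝ] Form 4)
    (hD : ∀ (A : V →ₗ[ℝ] V) (x y z w : V),
      D A ![x, y, z, w] =
        Φ₀ ![A x, y, z, w] + Φ₀ ![x, A y, z, w] + Φ₀ ![x, y, A z, w] + Φ₀ ![x, y, z, A w]) :
    (∀ A : V →ₗ[ℝ] V, A ∈ LinearMap.ker D ↔
      ((∀ x y : V, A x ⬝ᵥ y = -(x ⬝ᵥ A y)) ∧
        ∃ α : Form 2, (∀ x y : V, α ![x, y] = A x ⬝ᵥ y) ∧ M α = -α)) ∧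
    Module.finrank ℝ (LinearMap.ker D) = 21 := by
  refine ⟨fun A => ?_, finrank_ker hD⟩
  rw [mem_ker_iff hD]
  constructor
  · intro h
    have hA : ∀ i j, A (e i) j = -A (e j) i := fun i j => h.1 i j
    exact ⟨(skew_iff A).2 hA, skewForm A ((skew_iff A).2 hA), fun x y => rfl,
      (map_eq_neg_iff hM hA fun x y => rfl).2 h⟩
  · rintro ⟨hA, α, hα, hMα⟩
    exact (map_eq_neg_iff hM ((skew_iff A).1 hA) hα).1 hMα

end
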